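/- Suppose P is a unit Killing vector field: g(P,P) = 1 and g(∇_X P, Y) + g(∇_Y P, X) = 0 for all vector fields X, Y. Then for every vector field Y: S̄(Y,P) = S(Y,P) = S(P,Y) = S̄(P,Y). -/

import Mathlib

open scoped BigOperators

/-! Setup: an open set `U ⊆ ℝⁿ` with a Riemannian metric given by component functions
`g x i j`, the Levi-Civita connection computed from the Christoffel symbols, the
semi-symmetric metric connection `∇̄_X Y = ∇_X Y + π(Y)X − g(X,Y)P`, curvature and
Ricci tensors of a connection, and covariant derivatives of `(0,2)`-tensors. -/

/-- A vector field on (an open subset of) `ℝⁿ`. -/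
abbrev VF (n : ℕ) := (Fin n → ℝ) → Fin n → ℝ

/-- Partial derivative `∂ᵢ f` of a real-valued function. -/
noncomputable def pd {n : ℕ} (i : Fin n) (f : (Fin n → ℝ) → ℝ) (x : Fin n → ℝ) : ℝ :=
  fderiv ℝ f x (Pi.single i 1)

/-- The metric evaluated on two tangent vectors at the point `x`. -/
def gval {n : ℕ} (g : (Fin n → ℝ) → Fin n → Fin n → ℝ) (x v w : Fin n → ℝ) : ℝ :=
  ∑ i, ∑ j, g x i j * v i * w j

/-- The Christoffel symbols `Γ^k_{ij} = ½ g^{kl}(∂ᵢ g_{jl} + ∂ⱼ g_{il} − ∂_l g_{ij})`. -/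
noncomputable def christoffel {n : ℕ} (g : (Fin n → ℝ) → Fin n → Fin n → ℝ)
    (x : Fin n → ℝ) (k i j : Fin n) : ℝ :=
  (1 / 2) * ∑ l, (Matrix.of (g x))⁻¹ k l *
    (pd i (fun y => g y j l) x + pd j (fun y => g y i l) x - pd l (fun y => g y i j) x)

/-- The Levi-Civita covariant derivative `(∇_X Y)^k = X^i ∂ᵢ Y^k + Γ^k_{ij} X^i Y^j`. -/
noncomputable def lcCov {n : ℕ} (g : (Fin n → ℝ) → Fin n → Fin n → ℝ)
    (X Y : VF n) (x : Fin n → ℝ) : Fin n → ℝ :=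
  fun k => fderiv ℝ (fun y => Y y k) x (X x) +
    ∑ i, ∑ j, christoffel g x k i j * X x i * Y x j

/-- The semi-symmetric metric connection `∇̄_X Y = ∇_X Y + π(Y)X − g(X,Y)P`,
where `π(X) = g(X,P)`. -/
noncomputable def ssCov {n : ℕ} (g : (Fin n → ℝ) → Fin n → Fin n → ℝ)
    (P : VF n) (X Y : VF n) (x : Fin n → ℝ) : Fin n → ℝ :=
  fun k => lcCov g X Y x k + gval g x (Y x) (P x) * X x k - gval g x (X x) (Y x) * P x k

/-- The Lie bracket of vector fields. -/
noncomputable def lie {n : ℕ} (X Y : VF n) (x : Fin n → ℝ) : Fin n → ℝ :=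
  fun k => fderiv ℝ (fun y => Y y k) x (X x) - fderiv ℝ (fun y => X y k) x (Y x)

/-- The curvature `R_D(X,Y)Z = D_X D_Y Z − D_Y D_X Z − D_{[X,Y]}Z` of a connection `D`. -/
noncomputable def curv {n : ℕ} (D : VF n → VF n → VF n) (X Y Z : VF n)
    (x : Fin n → ℝ) : Fin n → ℝ :=
  fun k => D X (D Y Z) x k - D Y (D X Z) x k - D (lie X Y) Z x k

/-- The Ricci tensor `Ric_D(Y,Z) = trace (X ↦ R_D(X,Y)Z)` of a connection `D`
(the trace computed in the coordinate frame). -/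
noncomputable def ricci {n : ℕ} (D : VF n → VF n → VF n) (Y Z : VF n)
    (x : Fin n → ℝ) : ℝ :=
  ∑ i, curv D (fun _ => Pi.single i 1) Y Z x i

/-- The symmetrization `Ŝ(Y,Z) = ½(S̄(Y,Z) + S̄(Z,Y))` of the Ricci tensor of the
semi-symmetric metric connection. -/
noncomputable def shat {n : ℕ} (g : (Fin n → ℝ) → Fin n → Fin n → ℝ)
    (P : VF n) (Y Z : VF n) (x : Fin n → ℝ) : ℝ :=
  (ricci (ssCov g P) Y Z x + ricci (ssCov g P) Z Y x) / 2

/-- The covariant derivative `(D_X T)(Y,Z) = X(T(Y,Z)) − T(D_X Y, Z) − T(Y, D_X Z)` of a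
`(0,2)`-tensor `T` along the connection `D`. -/
noncomputable def covT {n : ℕ} (D : VF n → VF n → VF n)
    (T : VF n → VF n → (Fin n → ℝ) → ℝ) (X Y Z : VF n) (x : Fin n → ℝ) : ℝ :=
  fderiv ℝ (T Y Z) x (X x) - T (D X Y) Z x - T Y (D X Z) x

/-- Smoothness of a vector-field/metric-type map on `U`. -/
def SmoothVF {n : ℕ} {E : Type*} [NormedAddCommGroup E] [NormedSpace ℝ E]
    (U : Set (Fin n → ℝ)) (f : (Fin n → ℝ) → E) : Prop :=
  ContDiffOn ℝ (⊤ : ℕ∞) f U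


/-! ### Smoothness on `U` -/

/-- Pointwise smoothness of a scalar function on `U`. -/
def SmF {n : ℕ} (U : Set (Fin n → ℝ)) (f : (Fin n → ℝ) → ℝ) : Prop :=
  ∀ x ∈ U, ContDiffAt ℝ (⊤ : ℕ∞) f x

/-- Componentwise smoothness of a vector field on `U`. -/
def SmV {n : ℕ} (U : Set (Fin n → ℝ)) (X : VF n) : Prop :=
  ∀ k, SmF U (fun y => X y k)

theorem SmoothVF.smV {n : ℕ} {U : Set (Fin n → ℝ)} (hU : IsOpen U) {X : VF n}
    (h : SmoothVF U X) : SmV U X := by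
  intro k x hx
  exact contDiffAt_pi.1 (ContDiffOn.contDiffAt h (hU.mem_nhds hx)) k

theorem SmF.diff {n : ℕ} {U : Set (Fin n → ℝ)} {f : (Fin n → ℝ) → ℝ} (h : SmF U f)
    {x : Fin n → ℝ} (hx : x ∈ U) : DifferentiableAt ℝ f x :=
  (h x hx).differentiableAt (by simp)

theorem SmF.add {n : ℕ} {U : Set (Fin n → ℝ)} {f h : (Fin n → ℝ) → ℝ} (hf : SmF U f)
    (hh : SmF U h) : SmF U (fun y => f y + h y) := fun x hx => (hf x hx).add (hh x hx)

theorem SmF.sub {n : ℕ} {U : Set (Fin n → ℝ)} {f h : (Fin n → ℝ) → ℝ} (hf : SmF U f)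
    (hh : SmF U h) : SmF U (fun y => f y - h y) := fun x hx => (hf x hx).sub (hh x hx)

theorem SmF.mul {n : ℕ} {U : Set (Fin n → ℝ)} {f h : (Fin n → ℝ) → ℝ} (hf : SmF U f)
    (hh : SmF U h) : SmF U (fun y => f y * h y) := fun x hx => (hf x hx).mul (hh x hx)

theorem SmF.const {n : ℕ} {U : Set (Fin n → ℝ)} (c : ℝ) : SmF U (fun _ => c) :=
  fun _ _ => contDiffAt_const

theorem SmF.sum {n : ℕ} {U : Set (Fin n → ℝ)} {ι : Type*} {s : Finset ι}
    {f : ι → (Fin n → ℝ) → ℝ} (hf : ∀ i, SmF U (f i)) :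
    SmF U (fun y => ∑ i ∈ s, f i y) := fun x hx => ContDiffAt.sum fun i _ => hf i x hx

theorem SmF.prod {n : ℕ} {U : Set (Fin n → ℝ)} {ι : Type*} {s : Finset ι}
    {f : ι → (Fin n → ℝ) → ℝ} (hf : ∀ i, SmF U (f i)) :
    SmF U (fun y => ∏ i ∈ s, f i y) := fun x hx => contDiffAt_prod fun i _ => hf i x hx

theorem SmV.pi {n : ℕ} {U : Set (Fin n → ℝ)} {X : VF n} (h : SmV U X) {x : Fin n → ℝ}
    (hx : x ∈ U) : ContDiffAt ℝ (⊤ : ℕ∞) X x := contDiffAt_pi.2 fun k => h k x hx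

theorem SmV.const {n : ℕ} {U : Set (Fin n → ℝ)} (c : Fin n → ℝ) : SmV U (fun _ => c) :=
  fun k => SmF.const (c k)

theorem SmF.dd {n : ℕ} {U : Set (Fin n → ℝ)} {f : (Fin n → ℝ) → ℝ} {X : VF n}
    (hf : SmF U f) (hX : SmV U X) : SmF U (fun y => fderiv ℝ f y (X y)) := by
  intro x hx
  exact ((hf x hx).fderiv_right (m := ((⊤ : ℕ∞) : WithTop ℕ∞)) (by simp)).clm_apply (hX.pi hx)

theorem SmF.pd {n : ℕ} {U : Set (Fin n → ℝ)} {f : (Fin n → ℝ) → ℝ}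
    (hf : SmF U f) (i : Fin n) : SmF U (fun y => pd i f y) :=
  SmF.dd hf (SmV.const (Pi.single i 1))

theorem SmF.det {n : ℕ} {U : Set (Fin n → ℝ)} {M : (Fin n → ℝ) → Matrix (Fin n) (Fin n) ℝ}
    (hM : ∀ i j, SmF U (fun y => M y i j)) : SmF U (fun y => (M y).det) := by
  simp only [Matrix.det_apply']
  exact SmF.sum fun σ => (SmF.const _).mul (SmF.prod fun i => hM _ _)

theorem SmF.matInv {n : ℕ} {U : Set (Fin n → ℝ)} {M : (Fin n → ℝ) → Matrix (Fin n) (Fin n) ℝ}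
    (hM : ∀ i j, SmF U (fun y => M y i j)) (hd : ∀ y ∈ U, (M y).det ≠ 0) (i j : Fin n) :
    SmF U (fun y => (M y)⁻¹ i j) := by
  simp only [Matrix.inv_def, Ring.inverse_eq_inv', Matrix.smul_apply, smul_eq_mul]
  refine SmF.mul (fun x hx => (SmF.det hM x hx).inv (hd x hx)) ?_
  simp only [Matrix.adjugate_apply]
  apply SmF.det
  intro a b
  by_cases h : a = j
  · subst h; simp only [Matrix.updateRow_self]; exact SmF.const _
  · simp only [Matrix.updateRow_ne h]; exact hM _ _

/-- The standing hypotheses on the metric. -/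
structure Met {n : ℕ} (U : Set (Fin n → ℝ)) (g : (Fin n → ℝ) → Fin n → Fin n → ℝ) : Prop where
  op : IsOpen U
  sm : ∀ i j, SmF U (fun y => g y i j)
  symm : ∀ y ∈ U, ∀ i j, g y i j = g y j i
  det : ∀ y ∈ U, (Matrix.of (g y)).det ≠ 0

theorem Met.chr {n : ℕ} {U : Set (Fin n → ℝ)} {g : (Fin n → ℝ) → Fin n → Fin n → ℝ}
    (m : Met U g) (k i j : Fin n) : SmF U (fun y => christoffel g y k i j) := by
  unfold christoffel
  refine (SmF.const _).mul (SmF.sum fun l => SmF.mul ?_ ?_)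
  · exact SmF.matInv (M := fun y => Matrix.of (g y)) (fun i j => m.sm i j) m.det k l
  · exact (((m.sm j l).pd i).add ((m.sm i l).pd j)).sub ((m.sm i j).pd l)

theorem Met.lc {n : ℕ} {U : Set (Fin n → ℝ)} {g : (Fin n → ℝ) → Fin n → Fin n → ℝ}
    (m : Met U g) {X Y : VF n} (hX : SmV U X) (hY : SmV U Y) : SmV U (lcCov g X Y) := by
  intro k
  exact ((hY k).dd hX).add (SmF.sum fun i => SmF.sum fun j =>
    ((m.chr k i j).mul (hX i)).mul (hY j))

theorem Met.gv {n : ℕ} {U : Set (Fin n → ℝ)} {g : (Fin n → ℝ) → Fin n → Fin n → ℝ}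
    (m : Met U g) {X Y : VF n} (hX : SmV U X) (hY : SmV U Y) :
    SmF U (fun y => gval g y (X y) (Y y)) :=
  SmF.sum fun i => SmF.sum fun j => ((m.sm i j).mul (hX i)).mul (hY j)

theorem SmV.lie {n : ℕ} {U : Set (Fin n → ℝ)} {X Y : VF n} (hX : SmV U X) (hY : SmV U Y) :
    SmV U (lie X Y) := fun k => ((hY k).dd hX).sub ((hX k).dd hY)

/-! ### Algebra of `gval` -/

theorem gval_add_left {n : ℕ} (g : (Fin n → ℝ) → Fin n → Fin n → ℝ) (x u v w : Fin n → ℝ) :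
    gval g x (u + v) w = gval g x u w + gval g x v w := by
  simp only [gval, ← Finset.sum_add_distrib, Pi.add_apply]
  exact Finset.sum_congr rfl fun i _ => Finset.sum_congr rfl fun j _ => by ring

theorem gval_sub_left {n : ℕ} (g : (Fin n → ℝ) → Fin n → Fin n → ℝ) (x u v w : Fin n → ℝ) :
    gval g x (u - v) w = gval g x u w - gval g x v w := by
  simp only [gval, ← Finset.sum_sub_distrib, Pi.sub_apply]
  exact Finset.sum_congr rfl fun i _ => Finset.sum_congr rfl fun j _ => by ring

theorem gval_smul_left {n : ℕ} (g : (Fin n → ℝ) → Fin n → Fin n → ℝ) (x v w : Fin n → ℝ)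
    (c : ℝ) : gval g x (c • v) w = c * gval g x v w := by
  simp only [gval, Finset.mul_sum, Pi.smul_apply, smul_eq_mul]
  exact Finset.sum_congr rfl fun i _ => Finset.sum_congr rfl fun j _ => by ring

theorem Met.gsymm {n : ℕ} {U : Set (Fin n → ℝ)} {g : (Fin n → ℝ) → Fin n → Fin n → ℝ}
    (m : Met U g) {x : Fin n → ℝ} (hx : x ∈ U) (v w : Fin n → ℝ) :
    gval g x v w = gval g x w v := by
  simp only [gval]
  rw [Finset.sum_comm]
  exact Finset.sum_congr rfl fun i _ => Finset.sum_congr rfl fun j _ => by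
    rw [m.symm x hx j i]; ring

theorem gval_sum_single {n : ℕ} (g : (Fin n → ℝ) → Fin n → Fin n → ℝ) (x v w : Fin n → ℝ) :
    ∑ i, gval g x (Pi.single i 1) w * v i = gval g x v w := by
  have : ∀ i, gval g x (Pi.single i 1) w = ∑ j, g x i j * w j := by
    intro i
    rw [gval, Finset.sum_eq_single i]
    · simp
    · intro b _ hb; simp [Pi.single_eq_of_ne hb]
    · simp
  simp only [this, Finset.sum_mul]
  unfold gval
  exact Finset.sum_congr rfl fun i _ => Finset.sum_congr rfl fun j _ => by ring

/-- An endomorphism which is skew for `g` has trace zero. -/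
theorem Met.skew_trace {n : ℕ} {U : Set (Fin n → ℝ)} {g : (Fin n → ℝ) → Fin n → Fin n → ℝ}
    (m : Met U g) {x : Fin n → ℝ} (hx : x ∈ U) (A : Fin n → Fin n → ℝ)
    (h : ∀ i j, gval g x (A i) (Pi.single j 1) + gval g x (A j) (Pi.single i 1) = 0) :
    ∑ i, A i i = 0 := by
  set G := Matrix.of (g x) with hG
  set B := Matrix.of A with hB
  have hu : IsUnit G.det := isUnit_iff_ne_zero.2 (m.det x hx)
  have hGs : G.transpose = G := by ext i j; exact m.symm x hx j i
  have key : ∀ i j, gval g x (A i) (Pi.single j 1) = (B * G) i j := by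
    intro i j
    rw [gval, Matrix.mul_apply]
    refine Finset.sum_congr rfl fun k _ => ?_
    rw [Finset.sum_eq_single j]
    · simp [hB, hG, mul_comm]
    · intro b _ hb; simp [Pi.single_eq_of_ne hb]
    · simp
  have hM : (B * G).transpose = - (B * G) := by
    ext i j
    have := h i j
    rw [key, key] at this
    simp only [Matrix.transpose_apply, Matrix.neg_apply]
    linarith
  have e1 : B = (B * G) * G⁻¹ := by rw [Matrix.mul_assoc, Matrix.mul_nonsing_inv _ hu, Matrix.mul_one]
  have e2 : B.trace = - B.trace := by
    calc B.trace = ((B * G) * G⁻¹).trace := by rw [← e1]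
      _ = (((B * G) * G⁻¹).transpose).trace := (Matrix.trace_transpose _).symm
      _ = - (G⁻¹ * (B * G)).trace := by
        rw [Matrix.transpose_mul, hM, Matrix.transpose_nonsing_inv, hGs, Matrix.mul_neg,
          Matrix.trace_neg]
      _ = - ((B * G) * G⁻¹).trace := by rw [Matrix.trace_mul_comm]
      _ = - B.trace := by rw [← e1]
  have : B.trace = 0 := by linarith
  simpa [Matrix.trace, hB] using this

/-! ### Basic properties of the Levi-Civita connection -/

theorem fderiv_eq_sum {n : ℕ} (f : (Fin n → ℝ) → ℝ) (x v : Fin n → ℝ) :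
    fderiv ℝ f x v = ∑ i, v i * pd i f x := by
  conv_lhs => rw [pi_eq_sum_univ' v]
  simp [map_sum, pd]

theorem Met.pd_symm {n : ℕ} {U : Set (Fin n → ℝ)} {g : (Fin n → ℝ) → Fin n → Fin n → ℝ}
    (m : Met U g) {x : Fin n → ℝ} (hx : x ∈ U) (a i j : Fin n) :
    pd a (fun y => g y i j) x = pd a (fun y => g y j i) x := by
  unfold pd
  rw [Filter.EventuallyEq.fderiv_eq]
  filter_upwards [m.op.mem_nhds hx] with y hy using m.symm y hy i j

theorem Met.chr_symm {n : ℕ} {U : Set (Fin n → ℝ)} {g : (Fin n → ℝ) → Fin n → Fin n → ℝ}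
    (m : Met U g) {x : Fin n → ℝ} (hx : x ∈ U) (k i j : Fin n) :
    christoffel g x k i j = christoffel g x k j i := by
  unfold christoffel
  congr 1
  refine Finset.sum_congr rfl fun l _ => ?_
  rw [m.pd_symm hx l i j]; ring

theorem Met.chr_lower {n : ℕ} {U : Set (Fin n → ℝ)} {g : (Fin n → ℝ) → Fin n → Fin n → ℝ}
    (m : Met U g) {x : Fin n → ℝ} (hx : x ∈ U) (a i j : Fin n) :
    ∑ k, g x j k * christoffel g x k a i = (1 / 2) *
      (pd a (fun y => g y i j) x + pd i (fun y => g y a j) x - pd j (fun y => g y a i) x) := by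
  have hu : IsUnit (Matrix.of (g x)).det := isUnit_iff_ne_zero.2 (m.det x hx)
  set w : Fin n → ℝ := fun l =>
    pd a (fun y => g y i l) x + pd i (fun y => g y a l) x - pd l (fun y => g y a i) x with hw
  have h1 : ∀ k, christoffel g x k a i = (1/2) * ((Matrix.of (g x))⁻¹.mulVec w) k := by
    intro k; rfl
  have h2 : (Matrix.of (g x)).mulVec ((Matrix.of (g x))⁻¹.mulVec w) = w := by
    rw [Matrix.mulVec_mulVec, Matrix.mul_nonsing_inv _ hu, Matrix.one_mulVec]
  have h3 := congrFun h2 j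
  simp only [h1]
  change _ = (1/2) * w j
  rw [← h3]
  simp only [Matrix.mulVec, dotProduct, Matrix.of_apply, Finset.mul_sum]
  refine Finset.sum_congr rfl fun k _ => Finset.sum_congr rfl fun l _ => ?_
  ring

theorem Met.lie_eq {n : ℕ} {U : Set (Fin n → ℝ)} {g : (Fin n → ℝ) → Fin n → Fin n → ℝ}
    (m : Met U g) {x : Fin n → ℝ} (hx : x ∈ U) (X Y : VF n) :
    lie X Y x = lcCov g X Y x - lcCov g Y X x := by
  ext k
  simp only [lie, lcCov, Pi.sub_apply]
  have : ∑ i, ∑ j, christoffel g x k i j * X x i * Y x j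
      = ∑ i, ∑ j, christoffel g x k i j * Y x i * X x j := by
    rw [Finset.sum_comm]
    refine Finset.sum_congr rfl fun i _ => Finset.sum_congr rfl fun j _ => ?_
    rw [m.chr_symm hx k j i]; ring
  rw [this]; ring

theorem lc_dir {n : ℕ} (g : (Fin n → ℝ) → Fin n → Fin n → ℝ) (X Y : VF n) (x : Fin n → ℝ) :
    lcCov g X Y x = ∑ i, X x i • lcCov g (fun _ => Pi.single i 1) Y x := by
  ext k
  simp only [lcCov, Finset.sum_apply, Pi.smul_apply, smul_eq_mul, mul_add,
    Finset.sum_add_distrib]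
  congr 1
  · rw [fderiv_eq_sum]; rfl
  · refine Finset.sum_congr rfl fun i _ => ?_
    symm
    rw [Finset.sum_eq_single i]
    · simp only [Pi.single_eq_same, Finset.mul_sum]
      exact Finset.sum_congr rfl fun j _ => by ring
    · intro b _ hb; simp [Pi.single_eq_of_ne hb]
    · simp

theorem sum_swap3 {n : ℕ} (f : Fin n → Fin n → Fin n → ℝ) :
    ∑ k, ∑ a, ∑ j, f k a j = ∑ j, ∑ a, ∑ k, f k a j := by
  rw [Finset.sum_comm]
  conv_rhs => rw [Finset.sum_comm]
  exact Finset.sum_congr rfl fun a _ => Finset.sum_comm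

theorem Met.compat {n : ℕ} {U : Set (Fin n → ℝ)} {g : (Fin n → ℝ) → Fin n → Fin n → ℝ}
    (m : Met U g) {x : Fin n → ℝ} (hx : x ∈ U) (X : VF n) {Y Z : VF n}
    (hY : SmV U Y) (hZ : SmV U Z) :
    fderiv ℝ (fun y => gval g y (Y y) (Z y)) x (X x)
      = gval g x (lcCov g X Y x) (Z x) + gval g x (Y x) (lcCov g X Z x) := by
  have e : fderiv ℝ (fun y => gval g y (Y y) (Z y)) x (X x) =
      ∑ i, ∑ j, (fderiv ℝ (fun y => g y i j) x (X x) * Y x i * Z x j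
        + g x i j * fderiv ℝ (fun y => Y y i) x (X x) * Z x j
        + g x i j * Y x i * fderiv ℝ (fun y => Z y j) x (X x)) := by
    unfold gval
    rw [fderiv_fun_sum (fun i _ => (SmF.sum fun j =>
      ((m.sm i j).mul (hY i)).mul (hZ j)).diff hx)]
    rw [sum_apply]
    refine Finset.sum_congr rfl fun i _ => ?_
    rw [fderiv_fun_sum (fun j _ => (((m.sm i j).mul (hY i)).mul (hZ j)).diff hx)]
    rw [sum_apply]
    refine Finset.sum_congr rfl fun j _ => ?_
    rw [fderiv_fun_mul (((m.sm i j).mul (hY i)).diff hx) ((hZ j).diff hx),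
      fderiv_fun_mul ((m.sm i j).diff hx) ((hY i).diff hx)]
    simp only [add_apply, smul_apply, smul_eq_mul]
    ring
  have hG : ∑ i, ∑ j, fderiv ℝ (fun y => g y i j) x (X x) * Y x i * Z x j
      = ∑ i, ∑ j, ∑ a, (∑ k, g x j k * christoffel g x k a i) * X x a * Y x i * Z x j
      + ∑ i, ∑ j, ∑ a, (∑ k, g x i k * christoffel g x k a j) * X x a * Y x i * Z x j := by
    simp only [← Finset.sum_add_distrib]
    refine Finset.sum_congr rfl fun i _ => Finset.sum_congr rfl fun j _ => ?_
    rw [fderiv_eq_sum, Finset.sum_mul, Finset.sum_mul]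
    refine Finset.sum_congr rfl fun a _ => ?_
    rw [m.chr_lower hx, m.chr_lower hx, m.pd_symm hx a j i, m.pd_symm hx i a j,
      m.pd_symm hx j a i]
    rw [m.pd_symm hx i j a, m.pd_symm hx j i a]
    ring
  have hY' : gval g x (lcCov g X Y x) (Z x) =
      ∑ i, ∑ j, g x i j * fderiv ℝ (fun y => Y y i) x (X x) * Z x j
      + ∑ i, ∑ j, ∑ a, (∑ k, g x j k * christoffel g x k a i) * X x a * Y x i * Z x j := by
    simp only [gval, lcCov, mul_add, add_mul, Finset.sum_add_distrib]
    congr 1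
    simp only [Finset.sum_mul, Finset.mul_sum]
    rw [Finset.sum_comm]
    conv_rhs => rw [Finset.sum_comm]
    refine Finset.sum_congr rfl fun j _ => ?_
    rw [sum_swap3]
    refine Finset.sum_congr rfl fun i _ => Finset.sum_congr rfl fun a _ =>
      Finset.sum_congr rfl fun k _ => ?_
    rw [m.symm x hx k j]; ring
  have hZ' : gval g x (Y x) (lcCov g X Z x) =
      ∑ i, ∑ j, g x i j * Y x i * fderiv ℝ (fun y => Z y j) x (X x)
      + ∑ i, ∑ j, ∑ a, (∑ k, g x i k * christoffel g x k a j) * X x a * Y x i * Z x j := by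
    simp only [gval, lcCov, mul_add, Finset.sum_add_distrib]
    congr 1
    simp only [Finset.sum_mul, Finset.mul_sum]
    refine Finset.sum_congr rfl fun i _ => ?_
    rw [sum_swap3]
    refine Finset.sum_congr rfl fun j _ => Finset.sum_congr rfl fun a _ =>
      Finset.sum_congr rfl fun k _ => ?_
    ring
  rw [e, hY', hZ']
  simp only [Finset.sum_add_distrib]
  rw [hG]
  ring

/-! ### Curvature identities -/

/-- The commutator of directional derivatives. -/
theorem comm_dd {n : ℕ} {U : Set (Fin n → ℝ)} {X Y : VF n} {f : (Fin n → ℝ) → ℝ}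
    (hX : SmV U X) (hY : SmV U Y) (hf : SmF U f) {x : Fin n → ℝ} (hx : x ∈ U) :
    fderiv ℝ f x (lie X Y x) = fderiv ℝ (fun y => fderiv ℝ f y (Y y)) x (X x)
      - fderiv ℝ (fun y => fderiv ℝ f y (X y)) x (Y x) := by
  have two : (2 : WithTop ℕ∞) ≤ ((⊤ : ℕ∞) : WithTop ℕ∞) :=
    WithTop.coe_le_coe.2 (le_top : (2 : ℕ∞) ≤ ⊤)
  have hd : DifferentiableAt ℝ (fderiv ℝ f) x :=
    ((hf x hx).fderiv_right (m := ((⊤ : ℕ∞) : WithTop ℕ∞)) (by simp)).differentiableAt (by simp)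
  have hs : IsSymmSndFDerivAt ℝ f x := (hf x hx).isSymmSndFDerivAt (by simpa using two)
  have dX : DifferentiableAt ℝ X x := (hX.pi hx).differentiableAt (by simp)
  have dY : DifferentiableAt ℝ Y x := (hY.pi hx).differentiableAt (by simp)
  have hl : lie X Y x = fderiv ℝ Y x (X x) - fderiv ℝ X x (Y x) := by
    ext k
    simp only [lie, Pi.sub_apply]
    rw [fderiv_apply dX k, fderiv_apply dY k]
    rfl
  rw [fderiv_clm_apply hd dY, fderiv_clm_apply hd dX, hl, map_sub]
  simp only [add_apply, ContinuousLinearMap.comp_apply, ContinuousLinearMap.flip_apply]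
  rw [hs.eq (X x) (Y x)]
  ring

theorem lc_comb {n : ℕ} {U : Set (Fin n → ℝ)} (g : (Fin n → ℝ) → Fin n → Fin n → ℝ)
    {X A Y Q W : VF n} {a b : (Fin n → ℝ) → ℝ} (hA : SmV U A) (hY : SmV U Y) (hQ : SmV U Q)
    (ha : SmF U a) (hb : SmF U b) {x : Fin n → ℝ} (hx : x ∈ U) (hop : IsOpen U)
    (hW : ∀ y ∈ U, ∀ k, W y k = A y k + a y * Y y k - b y * Q y k) (k : Fin n) :
    lcCov g X W x k = lcCov g X A x k
      + (fderiv ℝ a x (X x) * Y x k + a x * lcCov g X Y x k)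
      - (fderiv ℝ b x (X x) * Q x k + b x * lcCov g X Q x k) := by
  have e : fderiv ℝ (fun y => W y k) x = fderiv ℝ (fun y => A y k + a y * Y y k - b y * Q y k) x := by
    apply Filter.EventuallyEq.fderiv_eq
    filter_upwards [hop.mem_nhds hx] with y hy using hW y hy k
  simp only [lcCov]
  rw [e, fderiv_fun_sub (((hA k).add (ha.mul (hY k))).diff hx) ((hb.mul (hQ k)).diff hx),
    fderiv_fun_add ((hA k).diff hx) ((ha.mul (hY k)).diff hx),
    fderiv_fun_mul (ha.diff hx) ((hY k).diff hx), fderiv_fun_mul (hb.diff hx) ((hQ k).diff hx)]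
  have s : ∑ i, ∑ j, christoffel g x k i j * X x i * W x j
      = ∑ i, ∑ j, christoffel g x k i j * X x i * A x j
      + a x * ∑ i, ∑ j, christoffel g x k i j * X x i * Y x j
      - b x * ∑ i, ∑ j, christoffel g x k i j * X x i * Q x j := by
    simp only [Finset.mul_sum, ← Finset.sum_add_distrib, ← Finset.sum_sub_distrib, hW x hx]
    exact Finset.sum_congr rfl fun i _ => Finset.sum_congr rfl fun j _ => by ring
  rw [s]
  simp only [sub_apply, add_apply, smul_apply, smul_eq_mul]
  ring

theorem lc_sub {n : ℕ} {U : Set (Fin n → ℝ)} (g : (Fin n → ℝ) → Fin n → Fin n → ℝ)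
    {X A Q W : VF n} (hA : SmV U A) (hQ : SmV U Q) {x : Fin n → ℝ} (hx : x ∈ U) (hop : IsOpen U)
    (hW : ∀ y ∈ U, W y = A y - Q y) (k : Fin n) :
    lcCov g X W x k = lcCov g X A x k - lcCov g X Q x k := by
  rw [lc_comb g (a := fun _ => 0) (b := fun _ => 1) hA hA hQ (SmF.const _) (SmF.const _) hx hop
    (fun y hy k => by rw [hW y hy]; simp)]
  simp

theorem lc_dir_sub {n : ℕ} (g : (Fin n → ℝ) → Fin n → Fin n → ℝ) {X A B Y : VF n}
    {x : Fin n → ℝ} (h : X x = A x - B x) :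
    lcCov g X Y x = lcCov g A Y x - lcCov g B Y x := by
  rw [lc_dir, lc_dir g A, lc_dir g B, h, ← Finset.sum_sub_distrib]
  exact Finset.sum_congr rfl fun i _ => by rw [Pi.sub_apply, sub_smul]

theorem jacobi {n : ℕ} {U : Set (Fin n → ℝ)} {X Y Z : VF n}
    (hX : SmV U X) (hY : SmV U Y) (hZ : SmV U Z) {x : Fin n → ℝ} (hx : x ∈ U) (k : Fin n) :
    lie X (lie Y Z) x k + lie Y (lie Z X) x k + lie Z (lie X Y) x k = 0 := by
  have L : ∀ {A B C : VF n}, SmV U A → SmV U B → SmV U C → lie A (lie B C) x k =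
      fderiv ℝ (fun y => fderiv ℝ (fun z => C z k) y (B y)) x (A x)
      - fderiv ℝ (fun y => fderiv ℝ (fun z => B z k) y (C y)) x (A x)
      - (fderiv ℝ (fun y => fderiv ℝ (fun z => A z k) y (C y)) x (B x)
      - fderiv ℝ (fun y => fderiv ℝ (fun z => A z k) y (B y)) x (C x)) := by
    intro A B C hA hB hC
    rw [← comm_dd hB hC (hA k) hx]
    conv_lhs => unfold lie
    rw [fderiv_fun_sub (((hC k).dd hB).diff hx) (((hB k).dd hC).diff hx)]
    rfl
  rw [L hX hY hZ, L hY hZ hX, L hZ hX hY]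
  ring

theorem Met.bianchi {n : ℕ} {U : Set (Fin n → ℝ)} {g : (Fin n → ℝ) → Fin n → Fin n → ℝ}
    (m : Met U g) {X Y Z : VF n}
    (hX : SmV U X) (hY : SmV U Y) (hZ : SmV U Z) {x : Fin n → ℝ} (hx : x ∈ U) (k : Fin n) :
    curv (lcCov g) X Y Z x k + curv (lcCov g) Y Z X x k + curv (lcCov g) Z X Y x k = 0 := by
  have T : ∀ {A B C : VF n}, SmV U A → SmV U B → SmV U C → lie A (lie B C) x k =
      lcCov g A (lcCov g B C) x k - lcCov g A (lcCov g C B) x k - lcCov g (lie B C) A x k := by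
    intro A B C hA hB hC
    rw [m.lie_eq hx A (lie B C), Pi.sub_apply,
      lc_sub g (m.lc hB hC) (m.lc hC hB) hx m.op (fun y hy => m.lie_eq hy B C)]
  have J := jacobi hX hY hZ hx k
  rw [T hX hY hZ, T hY hZ hX, T hZ hX hY] at J
  unfold curv
  linarith

theorem Met.skew {n : ℕ} {U : Set (Fin n → ℝ)} {g : (Fin n → ℝ) → Fin n → Fin n → ℝ}
    (m : Met U g) {X Y V W : VF n}
    (hX : SmV U X) (hY : SmV U Y) (hV : SmV U V) (hW : SmV U W) {x : Fin n → ℝ} (hx : x ∈ U) :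
    gval g x (curv (lcCov g) X Y V x) (W x) + gval g x (curv (lcCov g) X Y W x) (V x) = 0 := by
  have H : ∀ {A B : VF n}, SmV U A → SmV U B →
      fderiv ℝ (fun y => fderiv ℝ (fun z => gval g z (V z) (W z)) y (B y)) x (A x)
      = gval g x (lcCov g A (lcCov g B V) x) (W x) + gval g x (lcCov g B V x) (lcCov g A W x)
      + (gval g x (lcCov g A V x) (lcCov g B W x)
        + gval g x (V x) (lcCov g A (lcCov g B W) x)) := by
    intro A B hA hB
    rw [← m.compat hx A (m.lc hB hV) hW, ← m.compat hx A hV (m.lc hB hW), ← add_apply,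
      ← fderiv_fun_add ((m.gv (m.lc hB hV) hW).diff hx) ((m.gv hV (m.lc hB hW)).diff hx)]
    congr 1
    apply Filter.EventuallyEq.fderiv_eq
    filter_upwards [m.op.mem_nhds hx] with y hy using m.compat hy B hV hW
  have C := comm_dd hX hY (m.gv hV hW) hx
  rw [H hX hY, H hY hX, m.compat hx (lie X Y) hV hW] at C
  have E : ∀ Q : VF n, curv (lcCov g) X Y Q x = lcCov g X (lcCov g Y Q) x
    - lcCov g Y (lcCov g X Q) x - lcCov g (lie X Y) Q x := fun Q => rfl
  rw [E, E]
  simp only [gval_sub_left]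
  rw [m.gsymm hx (V x), m.gsymm hx (V x), m.gsymm hx (V x)] at C
  linarith

theorem curv_anti {n : ℕ} (g : (Fin n → ℝ) → Fin n → Fin n → ℝ) (X Y Z : VF n)
    (x : Fin n → ℝ) (k : Fin n) :
    curv (lcCov g) X Y Z x k = - curv (lcCov g) Y X Z x k := by
  have h : lcCov g (lie X Y) Z x = lcCov g (fun _ => 0) Z x - lcCov g (lie Y X) Z x := by
    apply lc_dir_sub
    ext k; simp [lie]
  have h0 : lcCov g (fun _ => 0) Z x k = 0 := by simp [lcCov]
  unfold curv
  rw [h, Pi.sub_apply, h0]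
  ring

/-- The Ricci tensor of the Levi-Civita connection is symmetric. -/
theorem Met.ricci_symm {n : ℕ} {U : Set (Fin n → ℝ)} {g : (Fin n → ℝ) → Fin n → Fin n → ℝ}
    (m : Met U g) {Y Z : VF n} (hY : SmV U Y) (hZ : SmV U Z) {x : Fin n → ℝ} (hx : x ∈ U) :
    ricci (lcCov g) Y Z x = ricci (lcCov g) Z Y x := by
  have tr := m.skew_trace hx (fun i => curv (lcCov g) Y Z (fun _ => Pi.single i 1) x)
    (fun i j => m.skew hY hZ (SmV.const (Pi.single i 1)) (SmV.const (Pi.single j 1)) hx)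
  have B : ∑ i, (curv (lcCov g) (fun _ => Pi.single i 1) Y Z x i
      + curv (lcCov g) Y Z (fun _ => Pi.single i 1) x i
      + curv (lcCov g) Z (fun _ => Pi.single i 1) Y x i) = 0 :=
    Finset.sum_eq_zero fun i _ => m.bianchi (SmV.const _) hY hZ hx i
  simp only [Finset.sum_add_distrib] at B
  simp only [curv_anti g Z, Finset.sum_neg_distrib] at B
  unfold ricci
  linarith

/-- Curvature of the semi-symmetric metric connection. -/
theorem Met.curv_ss {n : ℕ} {U : Set (Fin n → ℝ)} {g : (Fin n → ℝ) → Fin n → Fin n → ℝ}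
    (m : Met U g) {P X Y Z : VF n} (hP : SmV U P)
    (hX : SmV U X) (hY : SmV U Y) (hZ : SmV U Z) {x : Fin n → ℝ} (hx : x ∈ U) (k : Fin n) :
    curv (ssCov g P) X Y Z x k = curv (lcCov g) X Y Z x k
      + gval g x (lcCov g X P x) (Z x) * Y x k - gval g x (Y x) (Z x) * lcCov g X P x k
      - gval g x (lcCov g Y P x) (Z x) * X x k + gval g x (X x) (Z x) * lcCov g Y P x k
      + (gval g x (Z x) (P x) * gval g x (Y x) (P x)
          - gval g x (Y x) (Z x) * gval g x (P x) (P x)) * X x k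
      + gval g x (Y x) (Z x) * gval g x (X x) (P x) * P x k
      - (gval g x (Z x) (P x) * gval g x (X x) (P x)
          - gval g x (X x) (Z x) * gval g x (P x) (P x)) * Y x k
      - gval g x (X x) (Z x) * gval g x (Y x) (P x) * P x k := by
  have D : ∀ {A B : VF n}, SmV U A → SmV U B → lcCov g A (ssCov g P B Z) x k =
      lcCov g A (lcCov g B Z) x k
      + ((gval g x (lcCov g A Z x) (P x) + gval g x (Z x) (lcCov g A P x)) * B x k
        + gval g x (Z x) (P x) * lcCov g A B x k)
      - ((gval g x (lcCov g A B x) (Z x) + gval g x (B x) (lcCov g A Z x)) * P x k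
        + gval g x (B x) (Z x) * lcCov g A P x k) := by
    intro A B hA hB
    rw [← m.compat hx A hZ hP, ← m.compat hx A hB hZ]
    exact lc_comb g (m.lc hB hZ) hB hP (m.gv hZ hP) (m.gv hB hZ) hx m.op (fun _ _ _ => rfl) k
  have V : ∀ B : VF n, ssCov g P B Z x = lcCov g B Z x + gval g x (Z x) (P x) • B x
      - gval g x (B x) (Z x) • P x := fun B => rfl
  have O : ∀ A W : VF n, ssCov g P A W x k = lcCov g A W x k + gval g x (W x) (P x) * A x k
      - gval g x (W x) (A x) * P x k := by
    intro A W; rw [m.gsymm hx (W x) (A x)]; rfl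
  unfold curv
  rw [O, O, O, V, V, D hX hY, D hY hX, m.lie_eq hx X Y, m.gsymm hx (Z x) (lcCov g X Y x - _)]
  simp only [gval_sub_left, gval_add_left, gval_smul_left, Pi.sub_apply]
  rw [m.gsymm hx (Z x) (lcCov g X P x), m.gsymm hx (Z x) (lcCov g Y P x),
    m.gsymm hx (Y x) (lcCov g X Z x), m.gsymm hx (X x) (lcCov g Y Z x),
    m.gsymm hx (P x) (X x), m.gsymm hx (P x) (Y x), m.gsymm hx (Y x) (X x)]
  ring

/-- Ricci tensor of the semi-symmetric metric connection when `P` is divergence-free and unit. -/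
theorem Met.ricci_ss {n : ℕ} {U : Set (Fin n → ℝ)} {g : (Fin n → ℝ) → Fin n → Fin n → ℝ}
    (m : Met U g) {P Y Z : VF n} (hP : SmV U P)
    (hY : SmV U Y) (hZ : SmV U Z) {x : Fin n → ℝ} (hx : x ∈ U)
    (hu : gval g x (P x) (P x) = 1)
    (hdiv : ∑ i, lcCov g (fun _ => Pi.single i 1) P x i = 0) :
    ricci (ssCov g P) Y Z x = ricci (lcCov g) Y Z x
      - ((n : ℝ) - 2) * gval g x (lcCov g Y P x) (Z x)
      + ((n : ℝ) - 2) * (gval g x (Y x) (P x) * gval g x (Z x) (P x)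
        - gval g x (Y x) (Z x)) := by
  unfold ricci
  rw [Finset.sum_congr rfl fun i _ => m.curv_ss hP (SmV.const (Pi.single i 1)) hY hZ hx i]
  have t1 : ∑ i, gval g x (lcCov g (fun _ => Pi.single i 1) P x) (Z x) * Y x i
      = gval g x (lcCov g Y P x) (Z x) := by
    let F : (Fin n → ℝ) →+ ℝ := AddMonoidHom.mk' (fun v => gval g x v (Z x))
      (fun u v => gval_add_left g x u v _)
    have : gval g x (lcCov g Y P x) (Z x) = F (lcCov g Y P x) := rfl
    rw [this, lc_dir, map_sum]
    refine Finset.sum_congr rfl fun i _ => ?_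
    change _ = gval g x _ _
    rw [gval_smul_left, mul_comm]
  have t2 : ∑ i : Fin n, (Pi.single i 1 : Fin n → ℝ) i = n := by simp
  have s := gval_sum_single g x
  simp only [Finset.sum_add_distrib, Finset.sum_sub_distrib, sub_mul, mul_assoc,
    ← Finset.mul_sum, t1, t2, hdiv, s]
  rw [hu]
  have s2 : ∀ (c : ℝ) (v w : Fin n → ℝ), gval g x (fun i => c * v i) w = c * gval g x v w :=
    fun c v w => gval_smul_left g x v w c
  simp only [s2, m.gsymm hx (P x) (Z x)]
  ring

/-- On an open `U ⊆ ℝⁿ` (`n ≥ 3`) with Riemannian metric `g`, Levi-Civita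
connection `∇`, vector field `P`, semi-symmetric metric connection `∇̄`, `S = Ric_∇`,
`S̄ = Ric_∇̄`: suppose `P` is a unit Killing vector field (`g(P,P) = 1` and
`g(∇_X P, Y) + g(∇_Y P, X) = 0` for all vector fields `X, Y`).  Then for every vector
field `Y`: `S̄(Y,P) = S(Y,P) = S(P,Y) = S̄(P,Y)`. -/
theorem statement19 (n : ℕ) (hn : 3 ≤ n)
    (U : Set (Fin n → ℝ)) (hU : IsOpen U)
    (g : (Fin n → ℝ) → Fin n → Fin n → ℝ) (hg : SmoothVF U g)
    (hgpos : ∀ x ∈ U, (Matrix.of (g x)).PosDef)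
    (P : VF n) (hP : SmoothVF U P)
    (hPunit : ∀ x ∈ U, gval g x (P x) (P x) = 1)
    (hKilling : ∀ X Y : VF n, SmoothVF U X → SmoothVF U Y → ∀ x ∈ U,
      gval g x (lcCov g X P x) (Y x) + gval g x (lcCov g Y P x) (X x) = 0) :
    ∀ Y : VF n, SmoothVF U Y → ∀ x ∈ U,
      ricci (ssCov g P) Y P x = ricci (lcCov g) Y P x ∧
        ricci (lcCov g) Y P x = ricci (lcCov g) P Y x ∧
        ricci (lcCov g) P Y x = ricci (ssCov g P) P Y x := by
  intro Y hY x hx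
  have m : Met U g := by
    refine ⟨hU, ?_, ?_, ?_⟩
    · intro i j y hy
      exact contDiffAt_pi.1 (contDiffAt_pi.1 (ContDiffOn.contDiffAt hg (hU.mem_nhds hy)) i) j
    · intro y hy i j
      have := (hgpos y hy).isHermitian.apply j i
      simpa using this
    · intro y hy
      exact (hgpos y hy).det_pos.ne'
  have sP := SmoothVF.smV hU hP
  have sY := SmoothVF.smV hU hY
  have hu := hPunit x hx
  have hdiv : ∑ i, lcCov g (fun _ => Pi.single i 1) P x i = 0 :=
    m.skew_trace hx (fun i => lcCov g (fun _ => Pi.single i 1) P x) fun i j =>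
      hKilling (fun _ => Pi.single i 1) (fun _ => Pi.single j 1) contDiffOn_const
        contDiffOn_const x hx
  have hYP : gval g x (lcCov g Y P x) (P x) = 0 := by
    have h1 := m.compat hx Y sP sP
    have h2 : fderiv ℝ (fun y => gval g y (P y) (P y)) x = 0 := by
      have : (fun y => gval g y (P y) (P y)) =ᶠ[nhds x] fun _ => (1 : ℝ) := by
        filter_upwards [hU.mem_nhds hx] with y hy using hPunit y hy
      rw [this.fderiv_eq]; simp
    rw [h2, m.gsymm hx (P x)] at h1
    have h3 : (0 : (Fin n → ℝ) →L[ℝ] ℝ) (Y x) = 0 := rfl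
    rw [h3] at h1
    linarith
  have hPY : gval g x (lcCov g P P x) (Y x) = 0 := by
    have := hKilling Y P hY hP x hx
    linarith
  refine ⟨?_, m.ricci_symm sY sP hx, ?_⟩
  · rw [m.ricci_ss sP sY sP hx hu hdiv, hYP, hu]; ring
  · rw [m.ricci_ss sP sP sY hx hu hdiv, hPY, hu, m.gsymm hx (P x) (Y x)]; ring
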